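/- (Lemma 2.1, condition SI-2 for S(n)) Let n ≥ 2, X ∈ S(n)_{[1]} and Y ∈ S(n)_{[−1]}. Then [X,[Y,Z]] ∈ S(n)_{[0]} for every Z ∈ S(n)_{[0]}, so that ad X ∘ ad Y restricts to a linear endomorphism φ of the finite-dimensional space S(n)_{[0]}, and tr(φ) = 0. -/

import Mathlib

open MvPolynomial

noncomputable section

abbrev Wn (F : Type*) [Field F] (n : ℕ) :=
  Derivation F (MvPolynomial (Fin n) F) (MvPolynomial (Fin n) F)

/-- The submodule of polynomials homogeneous of integer degree `d`
(for `d < 0` this is `⊥`). -/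
def homZ (F : Type*) [Field F] (n : ℕ) (d : ℤ) : Submodule F (MvPolynomial (Fin n) F) where
  carrier := {p | ∀ m : Fin n →₀ ℕ, coeff m p ≠ 0 → (m.sum fun _ e => (e : ℤ)) = d}
  zero_mem' := by intro m hm; simp at hm
  add_mem' := by
    intro p q hp hq m hm
    by_cases h : coeff m p = 0
    · refine hq m fun hq0 => hm ?_
      simp [coeff_add, h, hq0]
    · exact hp m h
  smul_mem' := by
    intro c p hp m hm
    refine hp m fun h => hm ?_
    simp [coeff_smul, h]

/-- The homogeneous component `W(n)_{[i]}`. -/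
def Wgr (F : Type*) [Field F] (n : ℕ) (i : ℤ) : Submodule F (Wn F n) where
  carrier := {D | ∀ k, D (X k) ∈ homZ F n (i + 1)}
  zero_mem' := by intro k; simp
  add_mem' := by intro D E hD hE k; simpa using add_mem (hD k) (hE k)
  smul_mem' := by intro c D hD k; simpa using Submodule.smul_mem _ c (hD k)


/-- The divergence of a polynomial vector field. -/
def divg {F : Type*} [Field F] {n : ℕ} (D : Wn F n) : MvPolynomial (Fin n) F :=
  ∑ i, pderiv i (D (X i))

/-- The special algebra `S(n)` of divergence-free vector fields, as a submodule. -/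
def Sdiv (F : Type*) [Field F] (n : ℕ) : Submodule F (Wn F n) where
  carrier := {D | divg D = 0}
  zero_mem' := by simp [divg]
  add_mem' := by
    intro D E hD hE
    have h : divg (D + E) = divg D + divg E := by
      simp [divg, Finset.sum_add_distrib]
    simp only [Set.mem_setOf_eq] at *
    rw [h, hD, hE, add_zero]
  smul_mem' := by
    intro c D hD
    have h : divg (c • D) = c • divg D := by
      simp [divg, Finset.smul_sum]
    simp only [Set.mem_setOf_eq] at *
    rw [h, hD, smul_zero]

/-- The homogeneous component `S(n)_{[i]} = S(n) ∩ W(n)_{[i]}`, as a submodule. -/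
def Sgr (F : Type*) [Field F] (n : ℕ) (i : ℤ) : Submodule F (Wn F n) :=
  Sdiv F n ⊓ Wgr F n i

section Grading

variable {F : Type*} [Field F] {n : ℕ}

lemma mem_homZ_iff {d : ℤ} {p : MvPolynomial (Fin n) F} :
    p ∈ homZ F n d ↔ ∀ m : Fin n →₀ ℕ, coeff m p ≠ 0 → ((m.degree : ℕ) : ℤ) = d := by
  have h : ∀ m : Fin n →₀ ℕ, (m.sum fun _ e => (e : ℤ)) = ((m.degree : ℕ) : ℤ) := by
    intro m
    simp [Finsupp.sum, Finsupp.degree_apply]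
  simp only [← h]
  rfl

lemma mul_mem_homZ {d e : ℤ} {p q : MvPolynomial (Fin n) F}
    (hp : p ∈ homZ F n d) (hq : q ∈ homZ F n e) : p * q ∈ homZ F n (d + e) := by
  rw [mem_homZ_iff] at *
  intro m hm
  rw [coeff_mul] at hm
  obtain ⟨⟨a, b⟩, hab, hne⟩ := Finset.exists_ne_zero_of_sum_ne_zero hm
  rw [Finset.HasAntidiagonal.mem_antidiagonal] at hab
  rw [← hab, ← hp a (left_ne_zero_of_mul hne), ← hq b (right_ne_zero_of_mul hne)]
  simp

lemma pderiv_mem_homZ {d : ℤ} {p : MvPolynomial (Fin n) F} (hp : p ∈ homZ F n d) (i : Fin n) :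
    pderiv i p ∈ homZ F n (d - 1) := by
  rw [mem_homZ_iff] at *
  intro m hm
  rw [coeff_pderiv] at hm
  have := hp _ (left_ne_zero_of_mul hm)
  simp at this
  lia

lemma derivation_apply_eq_sum_pderiv (D : Wn F n) (p : MvPolynomial (Fin n) F) :
    D p = ∑ i, pderiv i p * D (X i) := by
  have hsum : ∀ q, (∑ i, D (X i) • pderiv i : Wn F n) q = ∑ i, pderiv i q * D (X i) := by
    intro q
    rw [← Derivation.coeFnAddMonoidHom_apply, map_sum, Finset.sum_apply]
    simp [mul_comm]
  have h : D = ∑ i, D (X i) • pderiv i := by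
    refine derivation_ext fun k => ?_
    simp [hsum, pderiv_X, Pi.single_apply]
  conv_lhs => rw [h]
  exact hsum p

lemma Wgr_apply_mem_homZ {i d : ℤ} {D : Wn F n} {p : MvPolynomial (Fin n) F}
    (hD : D ∈ Wgr F n i) (hp : p ∈ homZ F n d) : D p ∈ homZ F n (d + i) := by
  rw [derivation_apply_eq_sum_pderiv]
  refine Submodule.sum_mem _ fun k _ => ?_
  have := mul_mem_homZ (pderiv_mem_homZ hp k) (hD k)
  rwa [show d - 1 + (i + 1) = d + i by ring] at this

lemma lie_mem_Wgr {i j : ℤ} {D E : Wn F n} (hD : D ∈ Wgr F n i) (hE : E ∈ Wgr F n j) :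
    ⁅D, E⁆ ∈ Wgr F n (i + j) := by
  intro k
  rw [Derivation.commutator_apply]
  refine sub_mem ?_ ?_
  · have := Wgr_apply_mem_homZ hD (hE k)
    rwa [show j + 1 + i = i + j + 1 by ring] at this
  · have := Wgr_apply_mem_homZ hE (hD k)
    rwa [show i + 1 + j = i + j + 1 by ring] at this

lemma pderiv_apply_comm (D : Wn F n) (i : Fin n) (p : MvPolynomial (Fin n) F) :
    pderiv i (D p) = D (pderiv i p) + ∑ j, pderiv j p * pderiv i (D (X j)) := by
  have h := derivation_apply_eq_sum_pderiv ⁅(pderiv i : Wn F n), D⁆ p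
  have h0 : ∀ j, D (pderiv i (X j : MvPolynomial (Fin n) F)) = 0 := by
    intro j
    rcases eq_or_ne j i with rfl | hij
    · simp
    · simp [pderiv_X_of_ne (R := F) hij]
  simp only [Derivation.commutator_apply, h0, sub_zero] at h
  rw [← h]
  ring

lemma divg_lie (D E : Wn F n) : divg ⁅D, E⁆ = D (divg E) - E (divg D) := by
  have h : ∀ A B : Wn F n, ∑ i, pderiv i (A (B (X i))) =
      A (divg B) + ∑ i, ∑ j, pderiv j (B (X i)) * pderiv i (A (X j)) := by
    intro A B
    rw [divg, map_sum, ← Finset.sum_add_distrib]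
    exact Finset.sum_congr rfl fun i _ => pderiv_apply_comm A i _
  have hsymm : ∑ i, ∑ j, pderiv j (E (X i)) * pderiv i (D (X j)) =
      ∑ i, ∑ j, pderiv j (D (X i)) * pderiv i (E (X j)) := by
    rw [Finset.sum_comm]
    exact Finset.sum_congr rfl fun i _ => Finset.sum_congr rfl fun j _ => mul_comm _ _
  rw [divg]
  simp only [Derivation.commutator_apply, map_sub, Finset.sum_sub_distrib]
  rw [h D E, h E D, hsymm, add_sub_add_right_eq_sub]

lemma lie_mem_Sgr {i j : ℤ} {D E : Wn F n} (hD : D ∈ Sgr F n i) (hE : E ∈ Sgr F n j) :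
    ⁅D, E⁆ ∈ Sgr F n (i + j) := by
  refine ⟨?_, lie_mem_Wgr hD.2 hE.2⟩
  have h₁ : divg D = 0 := hD.1
  have h₂ : divg E = 0 := hE.1
  change divg ⁅D, E⁆ = 0
  rw [divg_lie, h₁, h₂, map_zero, map_zero, sub_zero]

lemma eq_C_coeff_of_mem_homZ_zero {p : MvPolynomial (Fin n) F} (hp : p ∈ homZ F n 0) :
    p = C (coeff 0 p) := by
  rw [mem_homZ_iff] at hp
  ext m
  rw [coeff_C]
  split_ifs with h
  · rw [h]
  · by_contra hm
    exact h ((Finsupp.degree_eq_zero_iff m).1 (by exact_mod_cast hp m hm)).symm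

/-- The vector field with constant coefficients `w`. -/
def constField (F : Type*) [Field F] (n : ℕ) : (Fin n → F) →ₗ[F] Wn F n where
  toFun w := mkDerivation F fun k => C (w k)
  map_add' v w := derivation_ext fun k => by simp
  map_smul' c w := derivation_ext fun k => by simp [smul_eq_C_mul]

@[simp]
lemma constField_X (w : Fin n → F) (k : Fin n) : constField F n w (X k) = C (w k) :=
  mkDerivation_X _ _ _

lemma constField_single (j : Fin n) : constField F n (Pi.single j 1) = pderiv j := by
  refine derivation_ext fun k => ?_
  rcases eq_or_ne k j with rfl | h
  · simp
  · simp [h, pderiv_X_of_ne h]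

lemma constField_mem_Sgr (w : Fin n → F) : constField F n w ∈ Sgr F n (-1) := by
  refine ⟨?_, fun k => ?_⟩
  · change divg _ = 0
    simp [divg]
  · rw [constField_X, mem_homZ_iff]
    intro m hm
    rw [coeff_C] at hm
    obtain rfl : 0 = m := by
      by_contra h
      simp [h] at hm
    simp

/-- The constant terms of the coefficients of a vector field. -/
def constTerm (F : Type*) [Field F] (n : ℕ) : Wn F n →ₗ[F] (Fin n → F) where
  toFun D k := coeff 0 (D (X k))
  map_add' D E := by ext k; simp
  map_smul' c D := by ext k; simp

lemma constTerm_apply (D : Wn F n) (k : Fin n) : constTerm F n D k = coeff 0 (D (X k)) := rfl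

lemma constField_constTerm {D : Wn F n} (hD : D ∈ Wgr F n (-1)) :
    constField F n (constTerm F n D) = D := by
  refine derivation_ext fun k => ?_
  rw [constField_X, constTerm_apply, ← eq_C_coeff_of_mem_homZ_zero (by simpa using hD k)]

instance finiteDimensional_Wgr_zero : FiniteDimensional F (Wgr F n 0) := by
  let L : Wgr F n 0 →ₗ[F] (Fin n → Fin n → F) :=
    { toFun := fun D k j => coeff (Finsupp.single j 1) (D.1 (X k))
      map_add' := fun D E => by ext; simp
      map_smul' := fun c D => by ext; simp }
  refine FiniteDimensional.of_injective L fun D E h => ?_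
  refine Subtype.ext (derivation_ext fun k => ?_)
  ext m
  by_cases hm : ((m.degree : ℕ) : ℤ) = 0 + 1
  · obtain ⟨j, rfl⟩ := (Finsupp.sum_eq_one_iff m).1 (by exact_mod_cast hm)
    exact congrFun (congrFun h k) j
  · rw [not_imp_comm.1 (mem_homZ_iff.1 (D.2 k) m) hm, not_imp_comm.1 (mem_homZ_iff.1 (E.2 k) m) hm]

instance free_Sgr (i : ℤ) : Module.Free F (Sgr F n i) :=
  Module.Free.of_divisionRing F ↥(Sgr F n i)

instance finiteDimensional_Sgr_zero : FiniteDimensional F (Sgr F n 0) :=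
  Submodule.finiteDimensional_of_le (inf_le_right : Sgr F n 0 ≤ Wgr F n 0)

lemma trace_constTerm_lie_lie_constField {D E : Wn F n} (hD : D ∈ Sdiv F n)
    (hE : E ∈ Wgr F n (-1)) :
    LinearMap.trace F (Fin n → F) (constTerm F n ∘ₗ (LieAlgebra.ad F (Wn F n) E) ∘ₗ
      (LieAlgebra.ad F (Wn F n) D) ∘ₗ constField F n) = 0 := by
  have hdiv : divg D = 0 := hD
  have hEX : ∀ k, E (X k) = C (coeff 0 (E (X k))) := fun k =>
    eq_C_coeff_of_mem_homZ_zero (by simpa using hE k)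
  have hterm : ∀ j, coeff 0 (⁅E, ⁅D, pderiv j⁆⁆ (X j)) = -coeff 0 (E (pderiv j (D (X j)))) := by
    intro j
    rw [Derivation.commutator_apply, hEX j]
    simp [Derivation.commutator_apply]
  rw [LinearMap.trace_eq_matrix_trace F (Pi.basisFun F (Fin n)), Matrix.trace]
  simp only [Matrix.diag_apply, LinearMap.toMatrix_apply, Pi.basisFun_apply, Pi.basisFun_repr,
    LinearMap.comp_apply, LieAlgebra.ad_apply, constField_single, constTerm_apply, hterm]
  rw [Finset.sum_neg_distrib, ← coeff_sum, ← map_sum]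
  change -coeff 0 (E (divg D)) = 0
  simp [hdiv]

end Grading

/-- for `n ≥ 2`, `X ∈ S(n)_{[1]}`, `Y ∈ S(n)_{[−1]}`:
`ad X ∘ ad Y` preserves `S(n)_{[0]}`, hence restricts to an endomorphism `φ`
of `S(n)_{[0]}`, and `tr(φ) = 0`. -/
theorem stmt14 (F : Type*) [Field F] [CharZero F] (n : ℕ) (hn : 2 ≤ n)
    (X Y : Wn F n) (hX : X ∈ Sgr F n 1) (hY : Y ∈ Sgr F n (-1)) :
    ∃ h : ∀ z ∈ Sgr F n 0,
        ((LieAlgebra.ad F (Wn F n) X) ∘ₗ (LieAlgebra.ad F (Wn F n) Y)) z ∈ Sgr F n 0,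
      LinearMap.trace F ↥(Sgr F n 0)
        (LinearMap.restrict ((LieAlgebra.ad F (Wn F n) X) ∘ₗ
          (LieAlgebra.ad F (Wn F n) Y)) h) = 0 := by
  have h : ∀ z ∈ Sgr F n 0,
      ((LieAlgebra.ad F (Wn F n) X) ∘ₗ (LieAlgebra.ad F (Wn F n) Y)) z ∈ Sgr F n 0 := by
    intro z hz
    simpa using lie_mem_Sgr hX (lie_mem_Sgr hY hz)
  refine ⟨h, ?_⟩
  let α : Sgr F n 0 →ₗ[F] (Fin n → F) :=
    constTerm F n ∘ₗ (LieAlgebra.ad F (Wn F n) Y) ∘ₗ (Sgr F n 0).subtype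
  let β : (Fin n → F) →ₗ[F] Sgr F n 0 :=
    ((LieAlgebra.ad F (Wn F n) X) ∘ₗ constField F n).codRestrict (Sgr F n 0) fun w => by
      simpa using lie_mem_Sgr hX (constField_mem_Sgr w)
  have hβα : LinearMap.restrict ((LieAlgebra.ad F (Wn F n) X) ∘ₗ
      (LieAlgebra.ad F (Wn F n) Y)) h = β ∘ₗ α := by
    refine LinearMap.ext fun z => Subtype.ext ?_
    change ⁅X, ⁅Y, (z : Wn F n)⁆⁆ = ⁅X, constField F n (constTerm F n ⁅Y, (z : Wn F n)⁆)⁆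
    rw [constField_constTerm (by simpa using lie_mem_Wgr hY.2 z.2.2)]
  rw [hβα]
  refine (LinearMap.trace_comp_comm' (M := Sgr F n 0) (N := Fin n → F) α β).trans ?_
  exact trace_constTerm_lie_lie_constField hX.1 hY.2
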